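/- Let n ≥ 2, let Ω be a bounded convex domain in ℝⁿ, let 0 < δ ≤ n, and let p > δ/n. Then there exists a constant c depending only on n, δ, and p such that inf_{b ∈ ℝ} ∫_Ω |u(x) − b|^p dH^δ_∞ ≤ c · (diam(Ω)^{np+p} / |Ω|^p) ∫_Ω |∇u(x)|^p dH^δ_∞ for all u ∈ C¹(Ω), where |Ω| denotes the Lebesgue measure of Ω. -/

import Mathlib

open MeasureTheory Metric Set Bornology
open scoped ENNReal NNReal

/-- The `δ`-dimensional Hausdorff content of a set `E ⊆ ℝⁿ`, defined as the infimum of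
`∑ᵢ rᵢ^δ` over all countable coverings of `E` by open balls `B(xᵢ, rᵢ)`. -/
noncomputable def hContent (n : ℕ) (δ : ℝ) (E : Set (EuclideanSpace ℝ (Fin n))) : ℝ≥0∞ :=
  ⨅ (x : ℕ → EuclideanSpace ℝ (Fin n)) (r : ℕ → ℝ≥0)
    (_ : E ⊆ ⋃ i, Metric.ball (x i) (r i)), ∑' i, (r i : ℝ≥0∞) ^ δ

/-- The `δ`-dimensional Hausdorff measure of `E ⊆ ℝⁿ`, obtained from coverings by open balls of
radii at most `ρ`, in the limit `ρ → 0⁺` (equivalently: the supremum over `ρ > 0`, since the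
infima increase as `ρ` decreases). -/
noncomputable def hMeasure (n : ℕ) (δ : ℝ) (E : Set (EuclideanSpace ℝ (Fin n))) : ℝ≥0∞ :=
  ⨆ (ρ : ℝ≥0) (_ : 0 < ρ),
    ⨅ (x : ℕ → EuclideanSpace ℝ (Fin n)) (r : ℕ → ℝ≥0)
      (_ : E ⊆ ⋃ i, Metric.ball (x i) (r i)) (_ : ∀ i, r i ≤ ρ), ∑' i, (r i : ℝ≥0∞) ^ δ

/-- The Choquet integral `∫_Ω f dH^δ_∞ = ∫₀^∞ H^δ_∞({x ∈ Ω : f x > t}) dt` of a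
(nonnegative) real-valued function with respect to the Hausdorff content. -/
noncomputable def choquet (n : ℕ) (δ : ℝ) (Ω : Set (EuclideanSpace ℝ (Fin n)))
    (f : EuclideanSpace ℝ (Fin n) → ℝ) : ℝ≥0∞ :=
  ∫⁻ t in Set.Ioi (0 : ℝ), hContent n δ {x ∈ Ω | t < f x}

/-- The Choquet integral of an `[0,∞]`-valued function with respect to the Hausdorff content. -/
noncomputable def echoquet (n : ℕ) (δ : ℝ) (Ω : Set (EuclideanSpace ℝ (Fin n)))
    (f : EuclideanSpace ℝ (Fin n) → ℝ≥0∞) : ℝ≥0∞ :=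
  ∫⁻ t in Set.Ioi (0 : ℝ), hContent n δ {x ∈ Ω | ENNReal.ofReal t < f x}

/-- The centered fractional Hardy–Littlewood maximal function
`M_κ f (x) = sup_{r>0} r^{κ-n} ∫_{B(x,r)} |f|`. -/
noncomputable def fracMaximal (n : ℕ) (κ : ℝ) (f : EuclideanSpace ℝ (Fin n) → ℝ)
    (x : EuclideanSpace ℝ (Fin n)) : ℝ≥0∞ :=
  ⨆ (r : ℝ) (_ : 0 < r),
    ENNReal.ofReal (r ^ (κ - n)) * ∫⁻ y in Metric.ball x r, ENNReal.ofReal |f y|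

/-- The Riesz potential of order `1`: `I₁ f (x) = ∫_{ℝⁿ} |f y| / |x-y|^{n-1} dy`. -/
noncomputable def rieszPot (n : ℕ) (f : EuclideanSpace ℝ (Fin n) → ℝ)
    (x : EuclideanSpace ℝ (Fin n)) : ℝ≥0∞ :=
  ∫⁻ y, ENNReal.ofReal |f y| / edist x y ^ ((n : ℝ) - 1)

/-- `Ω` is an `(α, β)`-John domain with John center `x₀`: every `x ∈ Ω` can be joined to `x₀`
by a rectifiable curve `γ : [0, L] → Ω` parametrized by arclength (hence `1`-Lipschitz) with
`γ 0 = x`, `γ L = x₀`, `L ≤ β` and `dist (γ t, ∂Ω) ≥ (α/β) t`. -/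
def IsJohnDomainWithCenter (n : ℕ) (α β : ℝ) (Ω : Set (EuclideanSpace ℝ (Fin n)))
    (x₀ : EuclideanSpace ℝ (Fin n)) : Prop :=
  x₀ ∈ Ω ∧ ∀ x ∈ Ω, ∃ L : ℝ, 0 ≤ L ∧ L ≤ β ∧ ∃ γ : ℝ → EuclideanSpace ℝ (Fin n),
    γ 0 = x ∧ γ L = x₀ ∧ (∀ t ∈ Set.Icc 0 L, γ t ∈ Ω) ∧
    LipschitzOnWith 1 γ (Set.Icc 0 L) ∧
    ∀ t ∈ Set.Icc 0 L, α / β * t ≤ Metric.infDist (γ t) (frontier Ω)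

/-- `Ω` is an `(α, β)`-John domain. -/
def IsJohnDomain (n : ℕ) (α β : ℝ) (Ω : Set (EuclideanSpace ℝ (Fin n))) : Prop :=
  ∃ x₀, IsJohnDomainWithCenter n α β Ω x₀

section Content

variable {n : ℕ}

theorem hContent_mono {δ : ℝ} {A B : Set (EuclideanSpace ℝ (Fin n))} (h : A ⊆ B) :
    hContent n δ A ≤ hContent n δ B := by
  unfold hContent
  refine iInf_mono fun x => iInf_mono fun r => ?_
  exact le_iInf fun hB => iInf_le_of_le (h.trans hB) le_rfl

/-- Coverings indexed by an arbitrary countable type bound the Hausdorff content. -/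
theorem hContent_le_tsum {ι : Type*} [Countable ι] {δ : ℝ} (hδ : 0 < δ)
    {A : Set (EuclideanSpace ℝ (Fin n))} (x : ι → EuclideanSpace ℝ (Fin n)) (r : ι → ℝ≥0)
    (h : A ⊆ ⋃ i, ball (x i) (r i)) :
    hContent n δ A ≤ ∑' i, (r i : ℝ≥0∞) ^ δ := by
  obtain ⟨e, he⟩ := exists_injective_nat ι
  have key : ∑' k, ((Function.extend e r 0 k : ℝ≥0) : ℝ≥0∞) ^ δ = ∑' i, (r i : ℝ≥0∞) ^ δ := by
    rw [← he.tsum_eq (f := fun k => ((Function.extend e r 0 k : ℝ≥0) : ℝ≥0∞) ^ δ)]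
    · simp [he.extend_apply]
    · intro k hk
      by_contra hne
      apply hk
      have : Function.extend e r 0 k = 0 := by
        rw [Function.extend_apply' _ _ _ hne]; rfl
      simp [this, hδ]
  rw [← key]
  unfold hContent
  refine iInf_le_of_le (Function.extend e x 0) (iInf_le_of_le (Function.extend e r 0)
    (iInf_le_of_le ?_ le_rfl))
  intro y hy
  obtain ⟨i, hi⟩ := mem_iUnion.1 (h hy)
  refine mem_iUnion.2 ⟨e i, ?_⟩
  simpa [he.extend_apply] using hi

theorem exists_cover_lt_of_hContent_lt {δ : ℝ} {A : Set (EuclideanSpace ℝ (Fin n))} {a : ℝ≥0∞}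
    (h : hContent n δ A < a) :
    ∃ (x : ℕ → EuclideanSpace ℝ (Fin n)) (r : ℕ → ℝ≥0),
      A ⊆ ⋃ i, ball (x i) (r i) ∧ ∑' i, (r i : ℝ≥0∞) ^ δ < a := by
  unfold hContent at h
  simp only [iInf_lt_iff] at h
  obtain ⟨x, r, hA, hr⟩ := h
  exact ⟨x, r, hA, hr⟩

theorem ENNReal.tsum_rpow_le {ι : Type*} (w : ι → ℝ≥0∞) {q : ℝ} (hq0 : 0 < q) (hq1 : q ≤ 1) :
    (∑' i, w i) ^ q ≤ ∑' i, w i ^ q := by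
  have hfin : ∀ s : Finset ι, (∑ i ∈ s, w i) ^ q ≤ ∑ i ∈ s, w i ^ q := by
    intro s
    classical
    induction s using Finset.induction_on with
    | empty => simp [hq0]
    | insert a s ha ih =>
      rw [Finset.sum_insert ha, Finset.sum_insert ha]
      exact (ENNReal.rpow_add_le_add_rpow _ _ hq0.le hq1).trans (by gcongr)
  have : ∑' i, w i ≤ (∑' i, w i ^ q) ^ q⁻¹ := by
    rw [ENNReal.tsum_eq_iSup_sum]
    refine iSup_le fun s => ?_
    rw [ENNReal.le_rpow_inv_iff hq0]
    exact (hfin s).trans (ENNReal.sum_le_tsum s)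
  rwa [ENNReal.le_rpow_inv_iff hq0] at this

theorem EuclideanSpace.volume_ball_eq (hn : 0 < n) (x : EuclideanSpace ℝ (Fin n)) (r : ℝ) :
    volume (ball x r) =
      ENNReal.ofReal r ^ n * volume (ball (0 : EuclideanSpace ℝ (Fin n)) 1) := by
  have : Nonempty (Fin n) := ⟨⟨0, hn⟩⟩
  simp [EuclideanSpace.volume_ball]

/-- Weak-type estimate for sums of weighted indicators of balls, in terms of the content. -/
theorem hContent_weighted_balls_le {ι : Type*} [Countable ι] (hn : 0 < n) {δ : ℝ} (hδ0 : 0 < δ)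
    (hδn : δ ≤ n) (α : ι → ℝ≥0∞) (hα : ∀ i, 1 ≤ α i)
    (x : ι → EuclideanSpace ℝ (Fin n)) (r : ι → ℝ≥0) :
    hContent n δ {y | ∃ ρ : ℝ, 0 < ρ ∧ volume (ball y ρ) <
        ∑' i, α i * volume (ball (x i) (r i) ∩ ball y ρ)} ≤
      (3 ^ δ + 11 ^ δ) * ∑' i, α i ^ (δ / n) * (r i : ℝ≥0∞) ^ δ := by
  have hn' : (0 : ℝ) < n := by exact_mod_cast hn
  have hq0 : 0 < δ / n := by positivity
  have hq1 : δ / n ≤ 1 := (div_le_one hn').2 hδn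
  set w : ι → ℝ≥0∞ := fun i => α i ^ (δ / n) * (r i : ℝ≥0∞) ^ δ with hw
  have hwm : ∀ i, (α i * (r i : ℝ≥0∞) ^ n) ^ (δ / n) = w i := by
    intro i
    rw [ENNReal.mul_rpow_of_nonneg _ _ hq0.le, ← ENNReal.rpow_natCast, ← ENNReal.rpow_mul,
      mul_div_cancel₀ _ hn'.ne']
  by_cases hS : ∑' i, w i = ∞
  · rw [hS, ENNReal.mul_top]
    · exact le_top
    · have : (0 : ℝ≥0∞) < 3 ^ δ := ENNReal.rpow_pos (by norm_num) (by norm_num)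
      exact (this.trans_le le_self_add).ne'
  set E := {y | ∃ ρ : ℝ, 0 < ρ ∧ volume (ball y ρ) <
        ∑' i, α i * volume (ball (x i) (r i) ∩ ball y ρ)} with hE
  set T : Set (EuclideanSpace ℝ (Fin n)) := E \ ⋃ i, ball (x i) (3 * r i) with hT
  have hex : ∀ y, ∃ ρ : ℝ, y ∈ T → 0 < ρ ∧ ENNReal.ofReal ρ ^ n <
      ∑' i : {i | x i ∈ closedBall y (2 * ρ)}, α i * (r i : ℝ≥0∞) ^ n := by
    intro y
    by_cases hy : y ∈ T
    swap
    · exact ⟨0, fun h => absurd h hy⟩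
    obtain ⟨⟨ρ, hρ, hlt⟩, hout⟩ := hy
    refine ⟨ρ, fun _ => ⟨hρ, ?_⟩⟩
    rw [EuclideanSpace.volume_ball_eq hn] at hlt
    have : ∑' i, α i * volume (ball (x i) (r i) ∩ ball y ρ) ≤
        (∑' i : {i | x i ∈ closedBall y (2 * ρ)}, α i * (r i : ℝ≥0∞) ^ n) *
          volume (ball (0 : EuclideanSpace ℝ (Fin n)) 1) := by
      rw [tsum_subtype {i | x i ∈ closedBall y (2 * ρ)} (fun i => α i * (r i : ℝ≥0∞) ^ n),
        ← ENNReal.tsum_mul_right]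
      refine ENNReal.tsum_le_tsum fun i => ?_
      by_cases hi : x i ∈ closedBall y (2 * ρ)
      · rw [indicator_of_mem (by exact hi), mul_assoc]
        gcongr
        refine (measure_mono inter_subset_left).trans ?_
        rw [EuclideanSpace.volume_ball_eq hn]
        simp
      · have hemp : ball (x i) (r i) ∩ ball y ρ = ∅ := by
          rw [eq_empty_iff_forall_notMem]
          rintro z ⟨hz1, hz2⟩
          apply hi
          have h3 : ¬ dist y (x i) < 3 * r i := fun h => hout (mem_iUnion.2 ⟨i, h⟩)
          rw [mem_ball] at hz1 hz2
          rw [mem_closedBall]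
          have := dist_triangle y z (x i)
          rw [dist_comm y z] at this
          rw [dist_comm]
          linarith
        simp [hemp]
    exact lt_of_mul_lt_mul_right' (hlt.trans_le this)
  choose ρ hρ using hex
  have hsum : ∑' i, α i * (r i : ℝ≥0∞) ^ n ≠ ∞ := by
    have := ENNReal.tsum_rpow_le (fun i => α i * (r i : ℝ≥0∞) ^ n) hq0 hq1
    simp only [hwm] at this
    intro h
    rw [h, ENNReal.top_rpow_of_pos hq0] at this
    exact hS (top_le_iff.1 this)
  obtain ⟨R, hR⟩ : ∃ R : ℝ, ∀ y ∈ T, 2 * ρ y ≤ R := by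
    refine ⟨2 * (max 1 (∑' i, α i * (r i : ℝ≥0∞) ^ n).toReal), fun y hy => ?_⟩
    obtain ⟨h0, h1⟩ := hρ y hy
    gcongr
    by_cases h : ρ y ≤ 1
    · exact h.trans (le_max_left _ _)
    refine le_max_of_le_right ?_
    rw [← ENNReal.ofReal_le_iff_le_toReal hsum]
    push Not at h
    calc ENNReal.ofReal (ρ y) ≤ ENNReal.ofReal (ρ y) ^ n :=
          le_self_pow₀ (by simpa using h.le) hn.ne'
      _ ≤ _ := h1.le
      _ ≤ _ := ENNReal.tsum_comp_le_tsum_of_injective Subtype.val_injective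
          (fun i => α i * (r i : ℝ≥0∞) ^ n)
  obtain ⟨u, huT, hdisj, hcov⟩ := Vitali.exists_disjoint_subfamily_covering_enlargement_closedBall
    T id (fun y => 2 * ρ y) R hR 5 (by norm_num)
  have hIne : ∀ b : u, ∃ i, x i ∈ closedBall (b : EuclideanSpace ℝ (Fin n)) (2 * ρ b) := by
    intro b
    by_contra! hne
    have := (hρ b (huT b.2)).2
    have hemp : {i | x i ∈ closedBall (b : EuclideanSpace ℝ (Fin n)) (2 * ρ b)} = ∅ :=
      eq_empty_iff_forall_notMem.2 hne
    rw [tsum_subtype {i | x i ∈ closedBall (b : EuclideanSpace ℝ (Fin n)) (2 * ρ b)}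
      (fun i => α i * (r i : ℝ≥0∞) ^ n), hemp] at this
    simp at this
  have huniq : ∀ (b c : u) (z : EuclideanSpace ℝ (Fin n)),
      z ∈ closedBall (b : EuclideanSpace ℝ (Fin n)) (2 * ρ b) →
      z ∈ closedBall (c : EuclideanSpace ℝ (Fin n)) (2 * ρ c) → b = c := by
    intro b c z hb hc
    by_contra hne
    exact disjoint_left.1 (hdisj b.2 c.2 (fun h => hne (Subtype.ext h))) hb hc
  have hucount : Countable u := by
    choose f hf using hIne
    refine Function.Injective.countable (f := f) fun b c hbc => ?_
    exact huniq b c (x (f b)) (hf b) (by rw [hbc]; exact hf c)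
  have hlarge : ∑' b : u, ENNReal.ofReal (ρ b) ^ δ ≤ ∑' i, w i := by
    calc ∑' b : u, ENNReal.ofReal (ρ b) ^ δ
        ≤ ∑' b : u, ∑' i : {i | x i ∈ closedBall (b : EuclideanSpace ℝ (Fin n)) (2 * ρ b)},
            w i := by
          refine ENNReal.tsum_le_tsum fun b => ?_
          have h1 := (hρ b (huT b.2)).2.le
          have h2 := (ENNReal.rpow_le_rpow h1 hq0.le).trans (ENNReal.tsum_rpow_le _ hq0 hq1)
          simp only [hwm] at h2
          rwa [← ENNReal.rpow_natCast, ← ENNReal.rpow_mul, mul_div_cancel₀ _ hn'.ne'] at h2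
      _ = ∑' s : Σ b : u, {i | x i ∈ closedBall (b : EuclideanSpace ℝ (Fin n)) (2 * ρ b)},
            w s.2 := (ENNReal.tsum_sigma' (fun s : Σ b : u,
          {i | x i ∈ closedBall (b : EuclideanSpace ℝ (Fin n)) (2 * ρ b)} => w s.2)).symm
      _ ≤ ∑' i, w i := by
          refine ENNReal.tsum_comp_le_tsum_of_injective
            (f := fun s : Σ b : u, {i | x i ∈ closedBall (b : EuclideanSpace ℝ (Fin n))
              (2 * ρ b)} => (s.2 : ι)) ?_ w
          rintro ⟨b, i, hi⟩ ⟨c, j, hj⟩ hij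
          dsimp only at hij
          subst hij
          obtain rfl := huniq b c _ hi hj
          rfl
  have hcover : E ⊆ ⋃ s : ι ⊕ u, ball
      (Sum.elim x (fun b : u => (b : EuclideanSpace ℝ (Fin n))) s)
      (Sum.elim (fun i => 3 * r i) (fun b : u => 11 * (ρ b).toNNReal) s : ℝ≥0) := by
    intro y hy
    by_cases hy' : y ∈ ⋃ i, ball (x i) (3 * r i)
    · obtain ⟨i, hi⟩ := mem_iUnion.1 hy'
      exact mem_iUnion.2 ⟨Sum.inl i, by simpa using hi⟩
    · have hyT : y ∈ T := ⟨hy, hy'⟩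
      obtain ⟨b, hb, hsub⟩ := hcov y hyT
      refine mem_iUnion.2 ⟨Sum.inr ⟨b, hb⟩, ?_⟩
      have h1 : dist y b ≤ 5 * (2 * ρ b) :=
        hsub (mem_closedBall_self (by have := (hρ y hyT).1; positivity))
      have hb0 := (hρ b (huT hb)).1
      simp only [Sum.elim_inr, mem_ball, NNReal.coe_mul, Real.coe_toNNReal _ hb0.le]
      norm_num
      linarith
  refine (hContent_le_tsum hδ0 _ _ hcover).trans ?_
  rw [ENNReal.summable.tsum_sum ENNReal.summable, add_mul]
  simp only [Sum.elim_inl, Sum.elim_inr, ENNReal.coe_mul, ENNReal.mul_rpow_of_nonneg _ _ hδ0.le,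
    ENNReal.tsum_mul_left]
  refine add_le_add ?_ ?_
  · norm_cast
    gcongr with i
    exact le_mul_of_one_le_left' (ENNReal.one_le_rpow (hα i) hq0)
  · gcongr
    · norm_num
    · exact hlarge

theorem exists_covers_tsum_lt {δ : ℝ} (A : ℕ → Set (EuclideanSpace ℝ (Fin n))) (w : ℕ → ℝ≥0∞)
    (h0 : ∀ j, w j ≠ 0) (hw : ∀ j, w j ≠ ∞) {a : ℝ≥0∞} (ha : ∑' j, w j * hContent n δ (A j) < a) :
    ∃ (x : ℕ → ℕ → EuclideanSpace ℝ (Fin n)) (r : ℕ → ℕ → ℝ≥0),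
      (∀ j, A j ⊆ ⋃ i, ball (x j i) (r j i)) ∧
        ∑' j, w j * ∑' i, (r j i : ℝ≥0∞) ^ δ < a := by
  obtain ⟨ε, hε, hεa⟩ := ENNReal.exists_pos_tsum_mul_lt_of_countable
    (tsub_pos_of_lt ha).ne' w hw
  have hfin : ∀ j, hContent n δ (A j) ≠ ∞ := by
    intro j hj
    have := ENNReal.le_tsum (f := fun j => w j * hContent n δ (A j)) j
    simp only [hj, ENNReal.mul_top (h0 j), top_le_iff] at this
    simp [this] at ha
  have := fun j => exists_cover_lt_of_hContent_lt
    (ENNReal.lt_add_right (hfin j) (ENNReal.coe_pos.2 (hε j)).ne')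
  choose x r hA hr using this
  refine ⟨x, r, hA, ?_⟩
  calc ∑' j, w j * ∑' i, (r j i : ℝ≥0∞) ^ δ
      ≤ ∑' j, (w j * hContent n δ (A j) + w j * ε j) := by
        refine ENNReal.tsum_le_tsum fun j => ?_
        rw [← mul_add]
        gcongr
        exact (hr j).le
    _ = ∑' j, w j * hContent n δ (A j) + ∑' j, w j * ε j := ENNReal.tsum_add
    _ < a := ?_
  have := ENNReal.add_lt_add_left ha.ne_top hεa
  rwa [add_tsub_cancel_of_le ha.le] at this

/-- Weak-type estimate for the Hardy–Littlewood maximal function and the Hausdorff content. -/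
theorem hContent_maximal_le (hn : 0 < n) {δ : ℝ} (hδ0 : 0 < δ) (hδn : δ ≤ n)
    (f : EuclideanSpace ℝ (Fin n) → ℝ) {s : ℝ} (hs : 0 < s) :
    hContent n δ {y | ∃ ρ : ℝ, 0 < ρ ∧ ENNReal.ofReal (2 * s) * volume (ball y ρ) <
        ∫⁻ z in ball y ρ, ENNReal.ofReal (f z)} ≤
      (3 ^ δ + 11 ^ δ) *
        ∑' j : ℕ, ((2 : ℝ≥0∞) ^ (j + 1)) ^ (δ / n) * hContent n δ {z | 2 ^ j * s < f z} := by
  have hn' : (0 : ℝ) < n := by exact_mod_cast hn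
  have hq0 : 0 < δ / n := by positivity
  have hC : (3 : ℝ≥0∞) ^ δ + 11 ^ δ ≠ ∞ := by simp
  have hC0 : (3 : ℝ≥0∞) ^ δ + 11 ^ δ ≠ 0 := by simp
  refine le_of_forall_gt fun a ha => ?_
  rw [mul_comm, ← ENNReal.lt_div_iff_mul_lt (Or.inl hC0) (Or.inl hC)] at ha
  obtain ⟨x, r, hA, hsum⟩ := exists_covers_tsum_lt
    (fun j => {z : EuclideanSpace ℝ (Fin n) | 2 ^ j * s < f z})
    (fun j => ((2 : ℝ≥0∞) ^ (j + 1)) ^ (δ / n)) (by simp [ENNReal.rpow_eq_zero_iff]) (by simp) ha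
  rw [ENNReal.lt_div_iff_mul_lt (Or.inl hC0) (Or.inl hC), mul_comm] at hsum
  refine lt_of_le_of_lt ?_ hsum
  have key := hContent_weighted_balls_le hn hδ0 hδn (fun k : ℕ × ℕ => (2 : ℝ≥0∞) ^ (k.1 + 1))
    (fun k => one_le_pow₀ (by norm_num)) (fun k => x k.1 k.2) (fun k => r k.1 k.2)
  rw [ENNReal.tsum_prod'] at key
  simp only [ENNReal.tsum_mul_left] at key
  refine le_trans (hContent_mono ?_) key
  rintro y ⟨ρ, hρ, hlt⟩
  refine ⟨ρ, hρ, ?_⟩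
  have hpt : ∀ z, ENNReal.ofReal (f z) ≤ ENNReal.ofReal s + ENNReal.ofReal s *
      ∑' k : ℕ × ℕ, (ball (x k.1 k.2) (r k.1 k.2)).indicator (fun _ => 2 ^ (k.1 + 1)) z := by
    intro z
    by_cases hz : f z ≤ s
    · exact (ENNReal.ofReal_le_ofReal hz).trans le_self_add
    push Not at hz
    obtain ⟨j, hj1, hj2⟩ : ∃ j : ℕ, 2 ^ j * s < f z ∧ f z ≤ 2 ^ (j + 1) * s := by
      by_contra! hcon
      have hall : ∀ j : ℕ, 2 ^ j * s < f z := by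
        intro j
        induction j with
        | zero => simpa using hz
        | succ j ih => exact hcon j ih
      obtain ⟨j, hj⟩ := pow_unbounded_of_one_lt (f z / s) (one_lt_two (α := ℝ))
      rw [div_lt_iff₀ hs] at hj
      exact absurd (hall j) (not_lt.2 hj.le)
    obtain ⟨i, hi⟩ := mem_iUnion.1 (hA j hj1)
    calc ENNReal.ofReal (f z) ≤ ENNReal.ofReal (2 ^ (j + 1) * s) := ENNReal.ofReal_le_ofReal hj2
      _ = ENNReal.ofReal s *
          (ball (x j i) (r j i)).indicator (fun _ => (2 : ℝ≥0∞) ^ (j + 1)) z := by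
        rw [indicator_of_mem hi, mul_comm, ENNReal.ofReal_mul hs.le,
          ENNReal.ofReal_pow (by norm_num)]
        simp
      _ ≤ ENNReal.ofReal s * ∑' k : ℕ × ℕ,
          (ball (x k.1 k.2) (r k.1 k.2)).indicator (fun _ => (2 : ℝ≥0∞) ^ (k.1 + 1)) z := by
        gcongr
        exact ENNReal.le_tsum (f := fun k : ℕ × ℕ =>
          (ball (x k.1 k.2) (r k.1 k.2)).indicator (fun _ => (2 : ℝ≥0∞) ^ (k.1 + 1)) z) (j, i)
      _ ≤ _ := le_add_self
  have hint : ∫⁻ z in ball y ρ, ENNReal.ofReal (f z) ≤ ENNReal.ofReal s * volume (ball y ρ) +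
      ENNReal.ofReal s * ∑' k : ℕ × ℕ, 2 ^ (k.1 + 1) *
        volume (ball (x k.1 k.2) (r k.1 k.2) ∩ ball y ρ) := by
    refine (lintegral_mono hpt).trans ?_
    rw [lintegral_add_left measurable_const, lintegral_const_mul' _ _ ENNReal.ofReal_ne_top,
      lintegral_tsum fun k => (measurable_const.indicator measurableSet_ball).aemeasurable]
    simp [measurableSet_ball, Measure.restrict_apply]
  have h2 := hlt.trans_le hint
  rw [ENNReal.ofReal_mul (by norm_num), ENNReal.ofReal_ofNat, two_mul, add_mul] at h2
  have h3 := lt_of_add_lt_add_left h2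
  exact lt_of_mul_lt_mul_left' h3

/-- The centered Hardy–Littlewood maximal function. -/
noncomputable def centeredMaximal (f : EuclideanSpace ℝ (Fin n) → ℝ≥0∞)
    (x : EuclideanSpace ℝ (Fin n)) : ℝ≥0∞ :=
  ⨆ (ρ : ℝ) (_ : 0 < ρ), (∫⁻ z in ball x ρ, f z) / volume (ball x ρ)

theorem setLIntegral_ball_le_centeredMaximal (f : EuclideanSpace ℝ (Fin n) → ℝ≥0∞)
    (x : EuclideanSpace ℝ (Fin n)) {ρ : ℝ} (hρ : 0 < ρ) :
    ∫⁻ z in ball x ρ, f z ≤ volume (ball x ρ) * centeredMaximal f x := by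
  have h : (∫⁻ z in ball x ρ, f z) / volume (ball x ρ) ≤ centeredMaximal f x :=
    le_iSup₂_of_le ρ hρ le_rfl
  rwa [ENNReal.div_le_iff (measure_ball_pos _ _ hρ).ne' measure_ball_lt_top.ne, mul_comm] at h

theorem setLIntegral_homothety_le {f : EuclideanSpace ℝ (Fin n) → ℝ≥0∞}
    (hf : Measurable f) (x : EuclideanSpace ℝ (Fin n)) {R t : ℝ} (hR : 0 < R) (ht : 0 < t) :
    ∫⁻ z in ball x R, f (x + t • (z - x)) ≤ volume (ball x R) * centeredMaximal f x := by
  set F : EuclideanSpace ℝ (Fin n) → ℝ≥0∞ := (ball x (t * R)).indicator f with hF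
  have hFm : Measurable F := hf.indicator measurableSet_ball
  have h1 : ∫⁻ z in ball x R, f (x + t • (z - x)) = ∫⁻ z, F (x + t • (z - x)) := by
    rw [← lintegral_indicator measurableSet_ball]
    refine lintegral_congr fun z => ?_
    have hiff : x + t • (z - x) ∈ ball x (t * R) ↔ z ∈ ball x R := by
      rw [mem_ball, mem_ball, dist_eq_norm, dist_eq_norm, add_sub_cancel_left, norm_smul,
        Real.norm_of_nonneg ht.le, mul_lt_mul_iff_right₀ ht]
    by_cases hz : z ∈ ball x R
    · rw [hF, indicator_of_mem hz, indicator_of_mem (hiff.2 hz)]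
    · rw [hF, indicator_of_notMem hz, indicator_of_notMem (fun h => hz (hiff.1 h))]
  have h2 : ∫⁻ z, F (x + t • (z - x)) = ENNReal.ofReal ((t ^ n)⁻¹) * ∫⁻ z, F z := by
    rw [lintegral_sub_right_eq_self (fun z => F (x + t • z)) x,
      ← lintegral_map (f := fun z => F (x + z)) (hFm.comp (measurable_const_add x))
        (measurable_const_smul t), Measure.map_addHaar_smul _ ht.ne', lintegral_smul_measure,
      lintegral_add_left_eq_self F x, finrank_euclideanSpace_fin, abs_of_pos (by positivity)]
    rfl
  rw [h1, h2, hF, lintegral_indicator measurableSet_ball]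
  calc ENNReal.ofReal ((t ^ n)⁻¹) * ∫⁻ z in ball x (t * R), f z
      ≤ ENNReal.ofReal ((t ^ n)⁻¹) * (volume (ball x (t * R)) * centeredMaximal f x) := by
        gcongr
        exact setLIntegral_ball_le_centeredMaximal f x (by positivity)
    _ = volume (ball x R) * centeredMaximal f x := by
        rw [Measure.addHaar_ball_mul_of_pos _ _ ht, finrank_euclideanSpace_fin, ← mul_assoc,
          ← mul_assoc, ← ENNReal.ofReal_mul (by positivity), inv_mul_cancel₀ (by positivity),
          ENNReal.ofReal_one, one_mul, ← Measure.addHaar_ball_center _ x R]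

theorem exists_centeredMaximal_le_two_mul {f : EuclideanSpace ℝ (Fin n) → ℝ≥0∞}
    {Ω : Set (EuclideanSpace ℝ (Fin n))} (hΩ : Ω.Nonempty) (hb : IsBounded Ω)
    (hf : ∀ x ∉ Ω, f x = 0) :
    ∃ y ∈ Ω, ∀ x ∈ Ω, centeredMaximal f y ≤ 2 * centeredMaximal f x := by
  obtain ⟨y₀, hy₀⟩ := hΩ
  by_cases hI : ∫⁻ z, f z = 0
  · refine ⟨y₀, hy₀, fun x _ => ?_⟩
    have : centeredMaximal f y₀ = 0 := by
      simp only [centeredMaximal, ENNReal.iSup_eq_zero]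
      intro ρ _
      rw [le_antisymm ((setLIntegral_le_lintegral _ _).trans hI.le) (zero_le), ENNReal.zero_div]
    simp [this]
  by_cases htop : ⨅ x ∈ Ω, centeredMaximal f x = ∞
  · refine ⟨y₀, hy₀, fun x hx => ?_⟩
    simp only [iInf_eq_top] at htop
    simp [htop x hx]
  have hpos : 0 < ⨅ x ∈ Ω, centeredMaximal f x := by
    set R := Metric.diam Ω + 1 with hR
    have hR0 : 0 < R := by have := Metric.diam_nonneg (s := Ω); linarith
    refine lt_of_lt_of_le (b := (∫⁻ z, f z) / volume (ball (0 : EuclideanSpace ℝ (Fin n)) R))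
      (ENNReal.div_pos hI measure_ball_lt_top.ne) (le_iInf₂ fun x hx => ?_)
    refine le_iSup₂_of_le R hR0 ?_
    rw [Measure.addHaar_ball_center _ x, ← setLIntegral_eq_of_support_subset]
    intro z hz
    have hzΩ : z ∈ Ω := by
      by_contra h
      exact hz (hf z h)
    have := Metric.dist_le_diam_of_mem hb hzΩ hx
    rw [mem_ball]
    linarith
  have hlt : ⨅ x ∈ Ω, centeredMaximal f x < 2 * ⨅ x ∈ Ω, centeredMaximal f x := by
    conv_lhs => rw [← one_mul (⨅ x ∈ Ω, centeredMaximal f x)]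
    exact ENNReal.mul_lt_mul_left hpos.ne' htop (by norm_num)
  simp only [iInf_lt_iff] at hlt
  obtain ⟨y, hy, hlt⟩ := hlt
  refine ⟨y, hy, fun x hx => hlt.le.trans ?_⟩
  gcongr
  exact iInf₂_le x hx

theorem enorm_sub_le_lintegral_segment {Ω : Set (EuclideanSpace ℝ (Fin n))} (ho : IsOpen Ω)
    (hc : Convex ℝ Ω) {u : EuclideanSpace ℝ (Fin n) → ℝ} (hu : ContDiffOn ℝ 1 u Ω)
    {x z : EuclideanSpace ℝ (Fin n)} (hx : x ∈ Ω) (hz : z ∈ Ω) :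
    ‖u z - u x‖ₑ ≤ ∫⁻ t in Ioc (0 : ℝ) 1,
      ENNReal.ofReal (Ω.indicator (fun w => ‖fderiv ℝ u w‖) (x + t • (z - x))) * ‖z - x‖ₑ := by
  have hmem : ∀ t ∈ Icc (0 : ℝ) 1, x + t • (z - x) ∈ Ω := fun t ht =>
    hc.add_smul_sub_mem hx hz ht
  have hderiv : ∀ t ∈ uIcc (0 : ℝ) 1, HasDerivAt (fun t : ℝ => u (x + t • (z - x)))
      (fderiv ℝ u (x + t • (z - x)) (z - x)) t := by
    intro t ht
    rw [uIcc_of_le zero_le_one] at ht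
    have h1 : HasFDerivAt u (fderiv ℝ u (x + t • (z - x))) (x + t • (z - x)) :=
      ((hu.differentiableOn one_ne_zero).differentiableAt (ho.mem_nhds (hmem t ht))).hasFDerivAt
    have h2 : HasDerivAt (fun t : ℝ => x + t • (z - x)) (z - x) t := by
      simpa using ((hasDerivAt_id t).smul_const (z - x)).const_add x
    exact h1.comp_hasDerivAt t h2
  have hcont : ContinuousOn (fun t : ℝ => fderiv ℝ u (x + t • (z - x)) (z - x))
      (uIcc (0 : ℝ) 1) := by
    rw [uIcc_of_le zero_le_one]
    refine ContinuousOn.clm_apply (ContinuousOn.comp (hu.continuousOn_fderiv_of_isOpen ho le_rfl)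
      (by fun_prop) fun t ht => hmem t ht) continuousOn_const
  have hftc := intervalIntegral.integral_eq_sub_of_hasDerivAt hderiv hcont.intervalIntegrable
  simp only [one_smul, zero_smul, add_zero, add_sub_cancel] at hftc
  rw [← hftc, intervalIntegral.integral_of_le zero_le_one]
  refine (enorm_integral_le_lintegral_enorm _).trans ?_
  refine setLIntegral_mono' measurableSet_Ioc fun t ht => ?_
  rw [indicator_of_mem (hmem t (Ioc_subset_Icc_self ht)), ofReal_norm]
  exact ContinuousLinearMap.le_opENorm _ _

theorem volume_mul_enorm_sub_le {Ω : Set (EuclideanSpace ℝ (Fin n))} (ho : IsOpen Ω)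
    (hc : Convex ℝ Ω) (hb : IsBounded Ω) {u : EuclideanSpace ℝ (Fin n) → ℝ}
    (hu : ContDiffOn ℝ 1 u Ω) {R : ℝ} (hR : Metric.diam Ω < R)
    {x y : EuclideanSpace ℝ (Fin n)} (hx : x ∈ Ω) (hy : y ∈ Ω) :
    volume Ω * ‖u x - u y‖ₑ ≤
      ENNReal.ofReal R * volume (ball (0 : EuclideanSpace ℝ (Fin n)) R) *
        (centeredMaximal (fun w => ENNReal.ofReal (Ω.indicator (fun w => ‖fderiv ℝ u w‖) w)) x +
         centeredMaximal (fun w => ENNReal.ofReal (Ω.indicator (fun w => ‖fderiv ℝ u w‖) w)) y) := by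
  have hR0 : 0 < R := Metric.diam_nonneg.trans_lt hR
  set f : EuclideanSpace ℝ (Fin n) → ℝ≥0∞ :=
    fun w => ENNReal.ofReal (Ω.indicator (fun w => ‖fderiv ℝ u w‖) w) with hf
  have hfm : Measurable f := ENNReal.measurable_ofReal.comp
    ((measurable_fderiv ℝ u).norm.indicator ho.measurableSet)
  have key : ∀ a ∈ Ω, ∫⁻ z in Ω, ‖u z - u a‖ₑ ≤
      ENNReal.ofReal R * volume (ball (0 : EuclideanSpace ℝ (Fin n)) R) * centeredMaximal f a := by
    intro a ha
    have hdist : ∀ z ∈ Ω, dist z a < R := fun z hz =>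
      (Metric.dist_le_diam_of_mem hb hz ha).trans_lt hR
    have hjm : Measurable (fun q : EuclideanSpace ℝ (Fin n) × ℝ => f (a + q.2 • (q.1 - a))) :=
      hfm.comp (by fun_prop)
    calc ∫⁻ z in Ω, ‖u z - u a‖ₑ
        ≤ ∫⁻ z in Ω, ∫⁻ t in Ioc (0 : ℝ) 1, f (a + t • (z - a)) * ENNReal.ofReal R := by
          refine setLIntegral_mono' ho.measurableSet fun z hz => ?_
          refine (enorm_sub_le_lintegral_segment ho hc hu ha hz).trans ?_
          refine lintegral_mono fun t => ?_
          dsimp only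
          rw [← ofReal_norm, ← dist_eq_norm]
          gcongr
          exact (hdist z hz).le
      _ ≤ ∫⁻ z in ball a R, ∫⁻ t in Ioc (0 : ℝ) 1, f (a + t • (z - a)) * ENNReal.ofReal R :=
          lintegral_mono_set fun z hz => hdist z hz
      _ = ∫⁻ t in Ioc (0 : ℝ) 1, ∫⁻ z in ball a R, f (a + t • (z - a)) * ENNReal.ofReal R :=
          lintegral_lintegral_swap (hjm.mul_const _).aemeasurable
      _ ≤ ∫⁻ t in Ioc (0 : ℝ) 1, ENNReal.ofReal R *
            volume (ball (0 : EuclideanSpace ℝ (Fin n)) R) * centeredMaximal f a := by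
          refine setLIntegral_mono' measurableSet_Ioc fun t ht => ?_
          rw [lintegral_mul_const' _ _ ENNReal.ofReal_ne_top, mul_comm, mul_assoc]
          gcongr
          rw [← Measure.addHaar_ball_center volume a R]
          exact setLIntegral_homothety_le hfm a hR0 ht.1
      _ = _ := by simp
  calc volume Ω * ‖u x - u y‖ₑ = ∫⁻ _ in Ω, ‖u x - u y‖ₑ := by
        rw [setLIntegral_const, mul_comm]
    _ ≤ ∫⁻ z in Ω, (‖u z - u x‖ₑ + ‖u z - u y‖ₑ) := by
        refine lintegral_mono fun z => ?_
        rw [← edist_eq_enorm_sub, ← edist_eq_enorm_sub, ← edist_eq_enorm_sub, edist_comm (u z)]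
        exact edist_triangle _ _ _
    _ = (∫⁻ z in Ω, ‖u z - u x‖ₑ) + ∫⁻ z in Ω, ‖u z - u y‖ₑ := by
        refine lintegral_add_left' ?_ _
        exact ((hu.continuousOn.sub continuousOn_const).aemeasurable ho.measurableSet).enorm
    _ ≤ _ := by
        rw [mul_add]
        exact add_le_add (key x hx) (key y hy)

theorem lintegral_Ioi_comp_mul_left {φ : ℝ → ℝ≥0∞} (hφ : Measurable φ) {a : ℝ} (ha : 0 < a) :
    ∫⁻ τ in Ioi (0 : ℝ), φ (a * τ) = ENNReal.ofReal a⁻¹ * ∫⁻ τ in Ioi (0 : ℝ), φ τ := by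
  rw [← lintegral_indicator measurableSet_Ioi, ← lintegral_indicator measurableSet_Ioi]
  have h : ∀ τ, (Ioi (0 : ℝ)).indicator (fun τ => φ (a * τ)) τ =
      (Ioi (0 : ℝ)).indicator φ (a * τ) := by
    intro τ
    simp only [indicator, mem_Ioi, mul_pos_iff_of_pos_left ha]
  simp_rw [h]
  rw [← lintegral_map (hφ.indicator measurableSet_Ioi) (measurable_const_mul a),
    Real.map_volume_mul_left ha.ne', lintegral_smul_measure, abs_of_pos (by positivity)]
  rfl

theorem exists_hContent_superlevel_le (hn : 0 < n) {δ : ℝ} (hδ0 : 0 < δ) (hδn : δ ≤ n)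
    {Ω : Set (EuclideanSpace ℝ (Fin n))} (ho : IsOpen Ω) (hne : Ω.Nonempty)
    (hc : Convex ℝ Ω) (hb : IsBounded Ω) {u : EuclideanSpace ℝ (Fin n) → ℝ}
    (hu : ContDiffOn ℝ 1 u Ω) {R : ℝ} (hR : Metric.diam Ω < R) {A : ℝ}
    (hA : 3 * R ^ (n + 1) * volume.real (ball (0 : EuclideanSpace ℝ (Fin n)) 1) =
      A * volume.real Ω) :
    ∃ b : ℝ, ∀ σ : ℝ, 0 < σ → hContent n δ {x ∈ Ω | σ < |u x - b|} ≤
      (3 ^ δ + 11 ^ δ) * ∑' j : ℕ, ((2 : ℝ≥0∞) ^ (j + 1)) ^ (δ / n) *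
        hContent n δ {z ∈ Ω | 2 ^ j * (σ / (2 * A)) < ‖fderiv ℝ u z‖} := by
  have hR0 : 0 < R := Metric.diam_nonneg.trans_lt hR
  have hV : 0 < volume.real Ω :=
    ENNReal.toReal_pos (ho.measure_pos volume hne).ne' hb.measure_lt_top.ne
  have hω : 0 < volume.real (ball (0 : EuclideanSpace ℝ (Fin n)) 1) :=
    ENNReal.toReal_pos (measure_ball_pos _ _ one_pos).ne' measure_ball_lt_top.ne
  have hA0 : 0 < A := by
    have : 0 < A * volume.real Ω := by rw [← hA]; positivity
    exact pos_of_mul_pos_left this hV.le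
  set f : EuclideanSpace ℝ (Fin n) → ℝ := Ω.indicator (fun w => ‖fderiv ℝ u w‖) with hf
  obtain ⟨y, hy, hmin⟩ := exists_centeredMaximal_le_two_mul
    (f := fun w => ENNReal.ofReal (f w)) hne hb (fun x hx => by simp [hf, hx])
  refine ⟨u y, fun σ hσ => ?_⟩
  have hs : 0 < σ / (2 * A) := by positivity
  refine le_trans (hContent_mono ?_) ((hContent_maximal_le hn hδ0 hδn f hs).trans ?_)
  · rintro x ⟨hx, hlt⟩
    have hM : ENNReal.ofReal (2 * (σ / (2 * A))) <
        centeredMaximal (fun w => ENNReal.ofReal (f w)) x := by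
      by_contra! hle
      have h1 := volume_mul_enorm_sub_le ho hc hb hu hR hx hy
      rw [← hf] at h1
      have h2 : volume Ω * ‖u x - u y‖ₑ ≤ ENNReal.ofReal (volume.real Ω * σ) := by
        calc volume Ω * ‖u x - u y‖ₑ
            ≤ ENNReal.ofReal R * volume (ball (0 : EuclideanSpace ℝ (Fin n)) R) *
              (centeredMaximal (fun w => ENNReal.ofReal (f w)) x +
                2 * centeredMaximal (fun w => ENNReal.ofReal (f w)) x) := by
              refine h1.trans ?_
              gcongr
              exact hmin x hx
          _ = ENNReal.ofReal R * volume (ball (0 : EuclideanSpace ℝ (Fin n)) R) *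
              (3 * centeredMaximal (fun w => ENNReal.ofReal (f w)) x) := by ring
          _ ≤ ENNReal.ofReal R * (ENNReal.ofReal R ^ n *
                ENNReal.ofReal (volume.real (ball (0 : EuclideanSpace ℝ (Fin n)) 1))) *
              (ENNReal.ofReal 3 * ENNReal.ofReal (2 * (σ / (2 * A)))) := by
              rw [EuclideanSpace.volume_ball_eq hn,
                ofReal_measureReal measure_ball_lt_top.ne, ENNReal.ofReal_ofNat]
              gcongr
          _ = ENNReal.ofReal (volume.real Ω * σ) := by
              rw [← ENNReal.ofReal_pow hR0.le, ← ENNReal.ofReal_mul (by positivity),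
                ← ENNReal.ofReal_mul (by positivity), ← ENNReal.ofReal_mul (by positivity),
                ← ENNReal.ofReal_mul (by positivity)]
              congr 1
              field_simp
              linear_combination hA
      rw [← ofReal_measureReal hb.measure_lt_top.ne, Real.enorm_eq_ofReal_abs,
        ← ENNReal.ofReal_mul hV.le, ENNReal.ofReal_le_ofReal_iff (by positivity)] at h2
      exact absurd (le_of_mul_le_mul_left h2 hV) (not_le.2 hlt)
    simp only [centeredMaximal, lt_iSup_iff] at hM
    obtain ⟨ρ, hρ, hM⟩ := hM
    refine ⟨ρ, hρ, ?_⟩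
    rwa [ENNReal.lt_div_iff_mul_lt (Or.inl (measure_ball_pos _ _ hρ).ne')
      (Or.inl measure_ball_lt_top.ne)] at hM
  · gcongr with j
    refine hContent_mono fun z hz => ?_
    rw [mem_ofPred_eq] at hz
    have h0 : 0 < 2 ^ j * (σ / (2 * A)) := by positivity
    by_cases hzΩ : z ∈ Ω
    · exact ⟨hzΩ, by rwa [hf, indicator_of_mem hzΩ] at hz⟩
    · rw [hf, indicator_of_notMem hzΩ] at hz
      exact absurd hz h0.not_gt

theorem tsum_weights_ne_top {q p : ℝ} (h : q < p) :
    ∑' j : ℕ, ((2 : ℝ≥0∞) ^ (j + 1)) ^ q * (ENNReal.ofReal ((2 : ℝ) ^ j)) ^ (-p) ≠ ∞ := by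
  have hw : ∀ j : ℕ, ((2 : ℝ≥0∞) ^ (j + 1)) ^ q * (ENNReal.ofReal ((2 : ℝ) ^ j)) ^ (-p) =
      2 ^ q * (2 ^ (q - p)) ^ j := by
    intro j
    rw [ENNReal.ofReal_pow (by norm_num), ENNReal.ofReal_ofNat, ← ENNReal.rpow_natCast,
      ← ENNReal.rpow_natCast, ← ENNReal.rpow_natCast, ← ENNReal.rpow_mul, ← ENNReal.rpow_mul,
      ← ENNReal.rpow_mul, ← ENNReal.rpow_add _ _ (by norm_num) (by norm_num),
      ← ENNReal.rpow_add _ _ (by norm_num) (by norm_num)]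
    congr 1
    push_cast
    ring
  simp_rw [hw]
  rw [ENNReal.tsum_mul_left, ENNReal.tsum_geometric]
  refine ENNReal.mul_ne_top (by simp) (ENNReal.inv_ne_top.2 (tsub_pos_of_lt ?_).ne')
  exact ENNReal.rpow_lt_one_of_one_lt_of_neg (by norm_num) (by linarith)

end Content

/-- Remark: Poincaré inequality in bounded convex domains w.r.t. Hausdorff
content. For `0 < δ ≤ n` and `p > δ/n` there is `c = c(n, δ, p)` such that for every bounded
convex domain `Ω ⊆ ℝⁿ` and every `u ∈ C¹(Ω)`,
`inf_b ∫_Ω |u-b|^p dH^δ_∞ ≤ c (diam Ω)^{np+p}/|Ω|^p ∫_Ω |∇u|^p dH^δ_∞`. -/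
theorem poincare_convex_content (n : ℕ) (hn : 2 ≤ n) (δ p : ℝ)
    (hδ0 : 0 < δ) (hδn : δ ≤ (n : ℝ)) (hp : δ / n < p) :
    ∃ c : ℝ≥0, 0 < c ∧
      ∀ Ω : Set (EuclideanSpace ℝ (Fin n)),
        IsOpen Ω → Ω.Nonempty → Convex ℝ Ω → IsBounded Ω →
        ∀ u : EuclideanSpace ℝ (Fin n) → ℝ, ContDiffOn ℝ 1 u Ω →
          ⨅ b : ℝ, choquet n δ Ω (fun x => |u x - b| ^ p)
            ≤ c * ENNReal.ofReal (Metric.diam Ω ^ ((n : ℝ) * p + p) / (volume Ω).toReal ^ p) *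
                choquet n δ Ω fun x => ‖fderiv ℝ u x‖ ^ p := by
  have hn0 : 0 < n := by omega
  have hn' : (0 : ℝ) < n := by exact_mod_cast hn0
  have hp0 : 0 < p := lt_trans (by positivity) hp
  set ω := volume.real (ball (0 : EuclideanSpace ℝ (Fin n)) 1) with hω
  have hω0 : 0 < ω :=
    ENNReal.toReal_pos (measure_ball_pos _ _ one_pos).ne' measure_ball_lt_top.ne
  set K : ℝ := 2 * (3 * 2 ^ (n + 1) * ω) with hK
  have hK0 : 0 < K := by positivity
  set W : ℝ≥0∞ := ∑' j : ℕ, ((2 : ℝ≥0∞) ^ (j + 1)) ^ (δ / n) *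
    (ENNReal.ofReal ((2 : ℝ) ^ j)) ^ (-p) with hW
  set c : ℝ≥0∞ := (3 ^ δ + 11 ^ δ) * W * ENNReal.ofReal (K ^ p) with hc
  have hctop : c ≠ ∞ := ENNReal.mul_ne_top
    (ENNReal.mul_ne_top (by simp) (tsum_weights_ne_top hp)) ENNReal.ofReal_ne_top
  refine ⟨c.toNNReal + 1, by positivity, fun Ω ho hne hconv hb u hu => ?_⟩
  have : Nontrivial (EuclideanSpace ℝ (Fin n)) :=
    Module.nontrivial_of_finrank_pos (R := ℝ) (by simpa using hn0)
  set d := Metric.diam Ω with hd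
  have hd0 : 0 < d := by
    obtain ⟨y, hy⟩ := hne
    obtain ⟨ε, hε, hball⟩ := Metric.isOpen_iff.1 ho y hy
    obtain ⟨v, hv⟩ := exists_norm_eq (EuclideanSpace ℝ (Fin n)) (half_pos hε).le
    have hyv : y + v ∈ Ω := hball (by simp [hv, hε])
    have := Metric.dist_le_diam_of_mem hb hyv hy
    rw [dist_eq_norm, add_sub_cancel_left, hv] at this
    linarith
  have hV : 0 < volume.real Ω :=
    ENNReal.toReal_pos (ho.measure_pos volume hne).ne' hb.measure_lt_top.ne
  set A : ℝ := 3 * (2 * d) ^ (n + 1) * ω / volume.real Ω with hA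
  have hA0 : 0 < A := by positivity
  obtain ⟨b, hlevel⟩ := exists_hContent_superlevel_le hn0 hδ0 hδn ho hne hconv hb hu
    (R := 2 * d) (A := A) (by linarith) (by rw [hA, div_mul_cancel₀ _ hV.ne'])
  set φ : ℝ → ℝ≥0∞ := fun τ => hContent n δ {x ∈ Ω | τ < ‖fderiv ℝ u x‖ ^ p} with hφ
  have hφm : Measurable φ := Antitone.measurable fun s t hst =>
    hContent_mono fun x hx => ⟨hx.1, hst.trans_lt hx.2⟩
  have hscale : ∀ j : ℕ, 0 < ((2 : ℝ) ^ j / (2 * A)) ^ p := fun j => by positivity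
  have hpt : ∀ τ ∈ Ioi (0 : ℝ), hContent n δ {x ∈ Ω | τ < |u x - b| ^ p} ≤
      (3 ^ δ + 11 ^ δ) * ∑' j : ℕ, ((2 : ℝ≥0∞) ^ (j + 1)) ^ (δ / n) *
        φ (((2 : ℝ) ^ j / (2 * A)) ^ p * τ) := by
    intro τ hτ
    rw [mem_Ioi] at hτ
    have hroot : (τ ^ p⁻¹) ^ p = τ := Real.rpow_inv_rpow hτ.le hp0.ne'
    have hroot0 : 0 < τ ^ p⁻¹ := by positivity
    refine (hContent_mono ?_).trans ((hlevel (τ ^ p⁻¹) hroot0).trans ?_)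
    · rintro x ⟨hx, hlt⟩
      rw [← hroot] at hlt
      exact ⟨hx, (Real.rpow_lt_rpow_iff hroot0.le (abs_nonneg _) hp0).1 hlt⟩
    · gcongr with j
      refine hContent_mono ?_
      rintro x ⟨hx, hlt⟩
      refine ⟨hx, ?_⟩
      conv_lhs => rw [← hroot, ← Real.mul_rpow (by positivity) hroot0.le]
      refine Real.rpow_lt_rpow (by positivity) (lt_of_eq_of_lt ?_ hlt) hp0
      ring
  have hconst : ∀ j : ℕ, ENNReal.ofReal (((2 : ℝ) ^ j / (2 * A)) ^ p)⁻¹ =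
      (ENNReal.ofReal ((2 : ℝ) ^ j)) ^ (-p) * ENNReal.ofReal ((2 * A) ^ p) := by
    intro j
    rw [ENNReal.ofReal_rpow_of_pos (by positivity), ← ENNReal.ofReal_mul (by positivity),
      Real.rpow_neg (by positivity), Real.div_rpow (by positivity) (by positivity), inv_div,
      div_eq_inv_mul]
  have hAp : (2 * A) ^ p = K ^ p * (d ^ ((n : ℝ) * p + p) / (volume Ω).toReal ^ p) := by
    have h1 : 2 * A = K * (d ^ (n + 1) / volume.real Ω) := by
      rw [hA, hK]; ring
    rw [h1, Real.mul_rpow hK0.le (by positivity), Real.div_rpow (by positivity) hV.le,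
      ← Real.rpow_natCast d, ← Real.rpow_mul hd0.le]
    congr 4
    push_cast
    ring
  refine (iInf_le _ b).trans ?_
  calc choquet n δ Ω (fun x => |u x - b| ^ p)
      ≤ ∫⁻ τ in Ioi (0 : ℝ), (3 ^ δ + 11 ^ δ) *
          ∑' j : ℕ, ((2 : ℝ≥0∞) ^ (j + 1)) ^ (δ / n) * φ (((2 : ℝ) ^ j / (2 * A)) ^ p * τ) :=
        setLIntegral_mono' measurableSet_Ioi hpt
    _ = (3 ^ δ + 11 ^ δ) * ∑' j : ℕ, ((2 : ℝ≥0∞) ^ (j + 1)) ^ (δ / n) *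
          (ENNReal.ofReal (((2 : ℝ) ^ j / (2 * A)) ^ p)⁻¹ * ∫⁻ τ in Ioi (0 : ℝ), φ τ) := by
        have hm : ∀ j : ℕ, Measurable fun τ => φ (((2 : ℝ) ^ j / (2 * A)) ^ p * τ) :=
          fun j => hφm.comp (measurable_const_mul _)
        rw [lintegral_const_mul' _ _ (by simp),
          lintegral_tsum fun j => ((hm j).const_mul _).aemeasurable]
        congr 1
        refine tsum_congr fun j => ?_
        rw [lintegral_const_mul _ (hm j), lintegral_Ioi_comp_mul_left hφm (hscale j)]
    _ = c * ENNReal.ofReal (d ^ ((n : ℝ) * p + p) / (volume Ω).toReal ^ p) *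
          ∫⁻ τ in Ioi (0 : ℝ), φ τ := by
        simp_rw [hconst, ← mul_assoc]
        rw [ENNReal.tsum_mul_right, ENNReal.tsum_mul_right, ← hW, hAp,
          ENNReal.ofReal_mul (by positivity), hc]
        ring
    _ ≤ _ := by
        refine mul_le_mul' (mul_le_mul_left ?_ _) le_rfl
        rw [ENNReal.coe_add, ENNReal.coe_toNNReal hctop]
        exact le_self_add
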